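/- Let a ≥ 2 and let p = r^a (the word consisting of a consecutive letters r). Then for all integers n ≥ 1 and m ≥ n: s_p(n, m) + s_p(n − a, m − 1) = s_p(n−1, m) + s_p(n, m−1). -/

import Mathlib

/-- A step of a lattice path: `u` (up) or `r` (right). -/
inductive Step : Type
  | u : Step
  | r : Step
deriving DecidableEq

/-- A word over the alphabet `{u, r}`. -/
abbrev Word := List Step

/-- The number of letters `r` in a word. -/
def countR (w : Word) : ℕ := w.count Step.r

/-- The number of letters `u` in a word. -/
def countU (w : Word) : ℕ := w.count Step.u

/-- `dval q` = (number of `r`'s in `q`) - (number of `u`'s in `q`). -/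
def dval (w : Word) : ℤ := (countR w : ℤ) - (countU w : ℤ)

/-- A pattern is depth-zero if every suffix `q` of it satisfies `dval q ≥ 0`. -/
def DepthZero (p : Word) : Prop := ∀ q : Word, q <:+ p → 0 ≤ dval q

/-- `o` is a bifix of `p`: a nonempty proper prefix of `p` that is also a (proper) suffix. -/
def IsBifix (o p : Word) : Prop := o ≠ [] ∧ o ≠ p ∧ o <+: p ∧ o <:+ p

/-- A pattern is bifix-free if it has no bifix. -/
def BifixFree (p : Word) : Prop := ∀ o : Word, ¬ IsBifix o p

/-- `w` is a ballot path to the lattice point `(n, m)`: it has exactly `n` letters `r`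
and `m` letters `u`, and every prefix has at least as many `u`'s as `r`'s. -/
def IsBallot (w : Word) (n m : ℤ) : Prop :=
  (countR w : ℤ) = n ∧ (countU w : ℤ) = m ∧
    ∀ t : Word, t <+: w → countR t ≤ countU t

/-- `w` avoids the pattern `p`: `p` does not occur in `w` as a contiguous substring. -/
def Avoids (p w : Word) : Prop := ¬ p <:+: w

/-- `s p n m` is the number of ballot paths to `(n, m)` avoiding `p`
(`0` if `n < 0`, `m < 0`, or `m < n`, since then no such path exists). -/
noncomputable def s (p : Word) (n m : ℤ) : ℕ :=
  Set.ncard {w : Word | IsBallot w n m ∧ Avoids p w}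

instance : Finite Step :=
  Finite.of_injective (fun x : Step => decide (x = Step.u)) (by
    intro x y h
    cases x <;> cases y <;> simp_all)

lemma length_eq_countR_add_countU (w : Word) : w.length = countR w + countU w := by
  induction w with
  | nil => rfl
  | cons x w ih => cases x <;> simp [countR, countU] at ih ⊢ <;> omega

lemma IsBallot.countR_le_countU {w : Word} {n m : ℤ} (h : IsBallot w n m) :
    countR w ≤ countU w :=
  h.2.2 w List.prefix_rfl

lemma finite_isBallot_avoids (p : Word) (n m : ℤ) :
    {w : Word | IsBallot w n m ∧ Avoids p w}.Finite := by
  refine (List.finite_length_eq Step (n + m).toNat).subset ?_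
  rintro w ⟨⟨hn, hm, -⟩, -⟩
  have := length_eq_countR_add_countU w
  simp only [Set.mem_ofPred_eq]
  omega

lemma isBallot_concat_u {w : Word} {n m : ℤ} :
    IsBallot (w ++ [Step.u]) n m ↔ IsBallot w n (m - 1) := by
  have hr : countR (w ++ [Step.u]) = countR w := by simp [countR]
  have hu : countU (w ++ [Step.u]) = countU w + 1 := by simp [countU]
  constructor
  · rintro ⟨h₁, h₂, h₃⟩
    exact ⟨by omega, by omega, fun t ht => h₃ t (ht.trans (List.prefix_append _ _))⟩
  · rintro h
    have hw := h.countR_le_countU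
    obtain ⟨h₁, h₂, h₃⟩ := h
    refine ⟨by omega, by omega, fun t ht => ?_⟩
    rcases List.prefix_concat_iff.1 ht with rfl | ht
    · omega
    · exact h₃ t ht

lemma isBallot_concat_r {w : Word} {n m : ℤ} (hnm : n ≤ m) :
    IsBallot (w ++ [Step.r]) n m ↔ IsBallot w (n - 1) m := by
  have hr : countR (w ++ [Step.r]) = countR w + 1 := by simp [countR]
  have hu : countU (w ++ [Step.r]) = countU w := by simp [countU]
  constructor
  · rintro ⟨h₁, h₂, h₃⟩
    exact ⟨by omega, by omega, fun t ht => h₃ t (ht.trans (List.prefix_append _ _))⟩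
  · rintro ⟨h₁, h₂, h₃⟩
    refine ⟨by omega, by omega, fun t ht => ?_⟩
    rcases List.prefix_concat_iff.1 ht with rfl | ht
    · omega
    · exact h₃ t ht

lemma isBallot_append_replicate_r {w : Word} (k : ℕ) {n m : ℤ} (hnm : n ≤ m) :
    IsBallot (w ++ List.replicate k Step.r) n m ↔ IsBallot w (n - k) m := by
  induction k generalizing n with
  | zero => simp
  | succ k ih =>
    rw [List.replicate_succ', ← List.append_assoc, isBallot_concat_r hnm, ih (by omega)]
    push_cast
    rw [sub_sub, add_comm (1 : ℤ)]

lemma replicate_r_suffix_concat_iff {k : ℕ} {w : Word} {x : Step} :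
    List.replicate (k + 1) Step.r <:+ w ++ [x] ↔
      x = Step.r ∧ List.replicate k Step.r <:+ w := by
  rw [List.replicate_succ']
  constructor
  · rintro ⟨t, ht⟩
    rw [← List.append_assoc] at ht
    obtain ⟨h₁, h₂⟩ := List.append_inj' ht rfl
    exact ⟨by simpa using h₂.symm, t, h₁⟩
  · rintro ⟨rfl, t, rfl⟩
    exact ⟨t, by simp⟩

lemma avoids_concat_iff {k : ℕ} {w : Word} {x : Step} :
    Avoids (List.replicate (k + 1) Step.r) (w ++ [x]) ↔
      Avoids (List.replicate (k + 1) Step.r) w ∧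
        ¬ (x = Step.r ∧ List.replicate k Step.r <:+ w) := by
  rw [Avoids, Avoids, List.infix_concat_iff, replicate_r_suffix_concat_iff]
  tauto

lemma not_replicate_r_suffix {k j : ℕ} (hjk : j < k) (v : Word) :
    ¬ List.replicate k Step.r <:+ v ++ [Step.u] ++ List.replicate j Step.r := by
  induction j generalizing k with
  | zero =>
    obtain ⟨k, rfl⟩ := Nat.exists_eq_succ_of_ne_zero (by omega : k ≠ 0)
    simp [replicate_r_suffix_concat_iff]
  | succ j ih =>
    obtain ⟨k, rfl⟩ := Nat.exists_eq_succ_of_ne_zero (by omega : k ≠ 0)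
    rw [List.replicate_succ' (n := j), ← List.append_assoc, Nat.succ_eq_add_one,
      replicate_r_suffix_concat_iff]
    exact fun h => ih (by omega) h.2

lemma avoids_append_u_replicate_r_iff {k j : ℕ} (hjk : j ≤ k) {v : Word} :
    Avoids (List.replicate (k + 1) Step.r) (v ++ [Step.u] ++ List.replicate j Step.r) ↔
      Avoids (List.replicate (k + 1) Step.r) v := by
  induction j with
  | zero => simp [avoids_concat_iff]
  | succ j ih =>
    rw [List.replicate_succ' (n := j), ← List.append_assoc, avoids_concat_iff, ih (by omega)]
    exact and_iff_left fun h => not_replicate_r_suffix (by omega) v h.2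

lemma exists_eq_append_u_replicate_r {k : ℕ} {w : Word}
    (hw : Avoids (List.replicate (k + 1) Step.r) w)
    (hs : List.replicate k Step.r <:+ w) (hu : 0 < countU w) :
    ∃ v : Word, w = v ++ [Step.u] ++ List.replicate k Step.r := by
  obtain ⟨t, rfl⟩ := hs
  rcases List.eq_nil_or_concat t with rfl | ⟨v, x, rfl⟩
  · simp [countU, List.count_replicate] at hu
  · cases x with
    | u => exact ⟨v, by simp⟩
    | r => exact absurd ⟨v, [], by simp [List.replicate_succ]⟩ hw

lemma finite_isBallot_avoids_concat_r (k : ℕ) (n m : ℤ) :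
    {w : Word | IsBallot w n m ∧
      Avoids (List.replicate (k + 1) Step.r) (w ++ [Step.r])}.Finite :=
  (finite_isBallot_avoids (List.replicate (k + 1) Step.r) n m).subset
    fun _ hw => ⟨hw.1, (avoids_concat_iff.1 hw.2).1⟩

/-- The words counted by `s p n m` that end in `u` are counted by `s p n (m - 1)`. -/
lemma s_replicate_r_eq_add {k : ℕ} {n m : ℤ} (hn : 1 ≤ n) (hnm : n ≤ m) :
    s (List.replicate (k + 1) Step.r) n m =
      s (List.replicate (k + 1) Step.r) n (m - 1) +
        {w : Word | IsBallot w (n - 1) m ∧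
          Avoids (List.replicate (k + 1) Step.r) (w ++ [Step.r])}.ncard := by
  have hinj (x : Step) : Function.Injective fun w : Word => w ++ [x] :=
    List.append_left_injective [x]
  rw [s, s, ← Set.ncard_image_of_injective {w : Word | IsBallot w n (m - 1) ∧ _} (hinj Step.u),
    ← Set.ncard_image_of_injective {w : Word | IsBallot w (n - 1) m ∧ _} (hinj Step.r),
    ← Set.ncard_union_eq _ ((finite_isBallot_avoids _ _ _).image _)
      ((finite_isBallot_avoids_concat_r k _ _).image _)]
  · congr 1
    ext w
    rcases List.eq_nil_or_concat w with rfl | ⟨v, x, rfl⟩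
    · simp only [Set.mem_union, Set.mem_image, Set.mem_ofPred_eq]
      constructor
      · rintro ⟨⟨h, -⟩, -⟩
        simp [countR] at h
        omega
      · rintro (⟨v, -, h⟩ | ⟨v, -, h⟩) <;> simp at h
    · cases x <;>
        simp [isBallot_concat_u, isBallot_concat_r hnm, avoids_concat_iff]
  · rw [Set.disjoint_left]
    rintro _ ⟨v, -, rfl⟩ ⟨w, -, h⟩
    simp at h

/-- A word counted by `s p (n - 1) m` either still avoids `p` after appending `r`, or it
ends in `u` followed by the longest proper suffix of `p`. -/
lemma s_replicate_r_sub_one_eq_add {k : ℕ} {n m : ℤ} (hn : 1 ≤ n) (hnm : n ≤ m) :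
    s (List.replicate (k + 1) Step.r) (n - 1) m =
      {w : Word | IsBallot w (n - 1) m ∧
          Avoids (List.replicate (k + 1) Step.r) (w ++ [Step.r])}.ncard +
        s (List.replicate (k + 1) Step.r) (n - (k + 1 : ℕ)) (m - 1) := by
  have hinj : Function.Injective
      fun v : Word => v ++ [Step.u] ++ List.replicate k Step.r :=
    (List.append_left_injective _).comp (List.append_left_injective _)
  have hmem (v : Word) : IsBallot (v ++ [Step.u] ++ List.replicate k Step.r) (n - 1) m ↔
      IsBallot v (n - (k + 1 : ℕ)) (m - 1) := by
    rw [isBallot_append_replicate_r k (by omega), isBallot_concat_u]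
    push_cast
    rw [sub_sub, add_comm (1 : ℤ)]
  rw [s, s,
    ← Set.ncard_image_of_injective {w : Word | IsBallot w (n - (k + 1 : ℕ)) (m - 1) ∧ _} hinj,
    ← Set.ncard_union_eq _ (finite_isBallot_avoids_concat_r k _ _)
      ((finite_isBallot_avoids _ _ _).image _)]
  · congr 1
    ext w
    simp only [Set.mem_union, Set.mem_image, Set.mem_ofPred_eq]
    constructor
    · rintro ⟨hb, hw⟩
      by_cases hs : List.replicate k Step.r <:+ w
      · have hu : 0 < countU w := by have := hb.2.1; omega
        obtain ⟨v, rfl⟩ := exists_eq_append_u_replicate_r hw hs hu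
        exact Or.inr ⟨v, ⟨(hmem v).1 hb, (avoids_append_u_replicate_r_iff le_rfl).1 hw⟩, rfl⟩
      · exact Or.inl ⟨hb, avoids_concat_iff.2 ⟨hw, fun h => hs h.2⟩⟩
    · rintro (⟨hb, hw⟩ | ⟨v, ⟨hb, hv⟩, rfl⟩)
      · exact ⟨hb, (avoids_concat_iff.1 hw).1⟩
      · exact ⟨(hmem v).2 hb, (avoids_append_u_replicate_r_iff le_rfl).2 hv⟩
  · rw [Set.disjoint_left]
    rintro _ ⟨-, hw⟩ ⟨v, -, rfl⟩
    exact (avoids_concat_iff.1 hw).2 ⟨rfl, List.suffix_append _ _⟩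

/-- Recurrence for ballot paths avoiding the pattern `r^a` (`a ≥ 2`): for integers
`n ≥ 1` and `m ≥ n`,
`s p n m + s p (n-a) (m-1) = s p (n-1) m + s p n (m-1)`. -/
theorem recurrence_avoiding_r_pow (a : ℕ) (ha : 2 ≤ a)
    (n m : ℤ) (hn : 1 ≤ n) (hm : n ≤ m) :
    s (List.replicate a Step.r) n m + s (List.replicate a Step.r) (n - a) (m - 1) =
      s (List.replicate a Step.r) (n - 1) m + s (List.replicate a Step.r) n (m - 1) := by
  obtain ⟨k, rfl⟩ := Nat.exists_eq_succ_of_ne_zero (by omega : a ≠ 0)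
  rw [Nat.succ_eq_add_one, s_replicate_r_eq_add hn hm, s_replicate_r_sub_one_eq_add hn hm]
  omega
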